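/- Let G be a finite simple graph, d ≥ 1 an integer, and M ⊆ V(G) a set such that G − M is a caterpillar forest. Let S ⊆ M be a set and H a subgraph of G − M such that S ∩ X ≠ ∅ for every chunk X with conf_H(X) > 0. Then there is a minimum d-coc set S_H of H that contains all vertices of H that are adjacent in G to some vertex of M \ S. -/

import Mathlib

namespace CocPaper

open SimpleGraph

variable {V : Type} {W : Type}

/-- `S` is a `d`-coc set of the subgraph of `G` induced on the vertex set `A`:
after deleting `S`, every connected component has at most `d` vertices. -/
def IsCocSetOn (G : SimpleGraph V) (A : Set V) (d : ℕ) (S : Set V) : Prop :=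
  ∀ c : (G.induce (A \ S)).ConnectedComponent, c.supp.ncard ≤ d

/-- The minimum size of a `d`-coc set of the subgraph of `G` induced on `A`. -/
noncomputable def cocOptOn (G : SimpleGraph V) (A : Set V) (d : ℕ) : ℕ :=
  sInf {m : ℕ | ∃ S : Set V, S ⊆ A ∧ IsCocSetOn G A d S ∧ S.ncard = m}

/-- `S` is a minimum `d`-coc set of the subgraph of `G` induced on `A`. -/
def IsMinCocSetOn (G : SimpleGraph V) (A : Set V) (d : ℕ) (S : Set V) : Prop :=
  S ⊆ A ∧ IsCocSetOn G A d S ∧ S.ncard = cocOptOn G A d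

/-- `X` is a `d`-blocking set of `G[A]`: no minimum `d`-coc set contains `X`. -/
def IsBlockingSetOn (G : SimpleGraph V) (A : Set V) (d : ℕ) (X : Set V) : Prop :=
  ∀ S : Set V, IsMinCocSetOn G A d S → ¬ X ⊆ S

/-- A minimal `d`-blocking set: a `d`-blocking set no proper subset of which is one. -/
def IsMinimalBlockingSetOn (G : SimpleGraph V) (A : Set V) (d : ℕ) (X : Set V) : Prop :=
  IsBlockingSetOn G A d X ∧ ∀ Y : Set V, Y ⊂ X → ¬ IsBlockingSetOn G A d Y

/-- `G` is (isomorphic to) a path graph, possibly empty. -/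
def IsPathGraph (G : SimpleGraph V) : Prop :=
  ∃ n : ℕ, Nonempty (G ≃g SimpleGraph.pathGraph n)

/-- A caterpillar: a tree such that deleting all vertices of degree one yields a
(possibly empty) path. -/
def IsCaterpillar (G : SimpleGraph V) : Prop :=
  G.IsTree ∧ IsPathGraph (G.induce {v : V | (G.neighborSet v).ncard ≠ 1})

/-- A caterpillar forest: every connected component is a caterpillar. -/
def IsCaterpillarForest (G : SimpleGraph V) : Prop :=
  ∀ c : G.ConnectedComponent, IsCaterpillar (G.induce c.supp)

/-- `G` is (isomorphic to) a cycle graph. -/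
def IsCycleGraph (G : SimpleGraph V) : Prop :=
  ∃ n : ℕ, 3 ≤ n ∧ Nonempty (G ≃g SimpleGraph.cycleGraph n)

/-- A connected subgraph of `G` which is a caterpillar, equipped with a fixed
nonempty spine listed in left-to-right order: the spine is a path in `G` inside
`verts`, and every vertex of `verts` off the spine has degree one in the subgraph. -/
structure SubCaterpillar (G : SimpleGraph V) where
  verts : Set V
  n : ℕ
  npos : 0 < n
  spine : Fin n → V
  spineMem : ∀ i, spine i ∈ verts
  spineInj : Function.Injective spine
  spineAdj : ∀ (i : ℕ) (h : i + 1 < n),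
    G.Adj (spine ⟨i, Nat.lt_of_succ_lt h⟩) (spine ⟨i + 1, h⟩)
  isTree : (G.induce verts).IsTree
  pendant : ∀ v ∈ verts, v ∉ Set.range spine → {w : V | w ∈ verts ∧ G.Adj v w}.ncard = 1

/-- The spine position of a vertex of the caterpillar: its spine index if it is a
spine vertex, and the spine index of its parent if it is a pendant. -/
noncomputable def SubCaterpillar.pos {G : SimpleGraph V} (C : SubCaterpillar G) (v : V) : ℕ :=
  sInf {i : ℕ | ∃ h : i < C.n,
    C.spine ⟨i, h⟩ = v ∨ (v ∉ Set.range C.spine ∧ G.Adj v (C.spine ⟨i, h⟩))}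

/-- `P` is a solution-tight packing of the spined caterpillar `C` with respect to `d`.
Packed (induced, connected) subgraphs are represented by their vertex sets. -/
def IsSTP (G : SimpleGraph V) (d : ℕ) (C : SubCaterpillar G) (P : Finset (Set V)) : Prop :=
  (∀ A ∈ P, A ⊆ C.verts ∧ d + 1 ≤ A.ncard ∧ (G.induce A).Connected) ∧
  ((↑P : Set (Set V)).Pairwise fun A B => Disjoint A B) ∧
  P.card = cocOptOn G C.verts d ∧
  (∀ A ∈ P, ∀ v ∈ C.verts, v ∉ Set.range C.spine → ∀ w ∈ A, G.Adj v w → v ∈ A) ∧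
  (∃ i : ℕ, i ≤ C.n ∧ ∀ j : Fin C.n, ((j : ℕ) < i ↔ ∃ A ∈ P, C.spine j ∈ A)) ∧
  (∀ A ∈ P, ∀ j : Fin C.n, C.spine j ∈ A →
    (∀ j' : Fin C.n, C.spine j' ∈ A → (j' : ℕ) ≤ (j : ℕ)) →
    IsCocSetOn G A d {C.spine j})

/-- A caterpillar forest on the vertex set `F` inside the ambient graph `G`,
with a fixed spine and spine order for each connected component. -/
structure SpinedCatForest (G : SimpleGraph V) (F : Set V) where
  numComps : ℕ
  comp : Fin numComps → SubCaterpillar G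
  sub : ∀ c, (comp c).verts ⊆ F
  cover : ∀ v ∈ F, ∃ c, v ∈ (comp c).verts
  disj : ∀ c c', c ≠ c' → Disjoint (comp c).verts (comp c').verts
  noCross : ∀ c c', c ≠ c' → ∀ v ∈ (comp c).verts, ∀ w ∈ (comp c').verts, ¬ G.Adj v w

/-- `P` is a solution-tight packing of the caterpillar forest `𝔉`: the union over the
connected components of solution-tight packings of the components. -/
def IsForestSTP (G : SimpleGraph V) (d : ℕ) {F : Set V} (𝔉 : SpinedCatForest G F)
    (P : Finset (Set V)) : Prop :=
  ∃ Q : Fin 𝔉.numComps → Finset (Set V),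
    (∀ c, IsSTP G d (𝔉.comp c) (Q c)) ∧
    (↑P : Set (Set V)) = ⋃ c, (↑(Q c) : Set (Set V))

/-- Attach `x` new pendant vertices to the vertex `v` of `H`. -/
def attachPendants (H : SimpleGraph W) (v : W) (x : ℕ) : SimpleGraph (W ⊕ Fin x) :=
  SimpleGraph.fromRel fun a b =>
    (∃ u u', a = Sum.inl u ∧ b = Sum.inl u' ∧ H.Adj u u') ∨
    (∃ i : Fin x, a = Sum.inl v ∧ b = Sum.inr i)

/-- The number of vertices of the connected component of `v` in the graph obtained
from `G[A]` by deleting `S` (this is `0` when `v ∈ S` or `v ∉ A`). -/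
noncomputable def compSizeOn (G : SimpleGraph V) (A S : Set V) (v : V) : ℕ :=
  {w : V | ∃ (hv : v ∈ A \ S) (hw : w ∈ A \ S),
    (G.induce (A \ S)).Reachable ⟨v, hv⟩ ⟨w, hw⟩}.ncard

/-- The essence of a spined caterpillar `C` relative to `d`. -/
noncomputable def SubCaterpillar.essence {G : SimpleGraph V} (C : SubCaterpillar G)
    (d : ℕ) : ℕ → ℕ := fun x =>
  let Cx : SimpleGraph (↥C.verts ⊕ Fin x) :=
    attachPendants (G.induce C.verts) ⟨C.spine ⟨0, C.npos⟩, C.spineMem ⟨0, C.npos⟩⟩ x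
  let vlast : ↥C.verts ⊕ Fin x :=
    Sum.inl ⟨C.spine ⟨C.n - 1, Nat.sub_lt C.npos Nat.one_pos⟩,
      C.spineMem ⟨C.n - 1, Nat.sub_lt C.npos Nat.one_pos⟩⟩
  if x ≤ d ∧ cocOptOn Cx Set.univ d = cocOptOn G C.verts d then
    sInf {b : ℕ | ∃ Y : Set (↥C.verts ⊕ Fin x),
      IsMinCocSetOn Cx Set.univ d Y ∧ b = compSizeOn Cx Set.univ Y vlast}
  else d + 1

/-- The set of vertices of `A` adjacent (in `G`) to some vertex of `X`. -/
def nbrIn (G : SimpleGraph V) (A X : Set V) : Set V :=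
  {v : V | v ∈ A ∧ ∃ m ∈ X, G.Adj v m}

/-- The chunk `X` imposes a (strictly positive) conflict on the subgraph of `G`
induced on the vertex set `A`. -/
def HasConflict (G : SimpleGraph V) (d : ℕ) (A X : Set V) : Prop :=
  cocOptOn G A d < (nbrIn G A X).ncard + cocOptOn G (A \ nbrIn G A X) d

/-- A chunk: a subset of the modulator `M` of size one or two. -/
def IsChunk (M X : Set V) : Prop := X ⊆ M ∧ 1 ≤ X.ncard ∧ X.ncard ≤ 2

/-- The `i`-th graph (0-based) of the `α`-merged packing of the ordered packing `H`. -/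
def mergedPiece {t : ℕ} (H : Fin t → Set V) (α i : ℕ) : Set V :=
  ⋃ (j : Fin t) (_ : i * α ≤ (j : ℕ) ∧ (j : ℕ) < i * α + α), H j

/-- `H` enumerates a solution-tight packing of `C` in left-to-right spine order. -/
def IsOrderedSTP (G : SimpleGraph V) (d : ℕ) (C : SubCaterpillar G) {t : ℕ}
    (H : Fin t → Set V) : Prop :=
  Function.Injective H ∧
  (∃ P : Finset (Set V), IsSTP G d C P ∧ (↑P : Set (Set V)) = Set.range H) ∧
  ∀ k k' : Fin t, k < k' → ∀ v ∈ H k, ∀ w ∈ H k', C.pos v < C.pos w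

/-- Composition of a list of functions: `compList [g₁, …, gₗ] = g₁ ∘ g₂ ∘ ⋯ ∘ gₗ`. -/
def compList (L : List (ℕ → ℕ)) : ℕ → ℕ := L.foldr (· ∘ ·) id

/-- `inc^d_i`: maps `i` to `i+1` and fixes all other inputs. -/
def incAt (i : ℕ) : ℕ → ℕ := fun x => if x = i then i + 1 else x

/-- `dec^d_i`: maps `i` to `i-1` and fixes all other inputs. -/
def decAt (i : ℕ) : ℕ → ℕ := fun x => if x = i then i - 1 else x

/-- `inc^d`: maps every `x` with `1 ≤ x ≤ d` to `x+1` and fixes all other inputs. -/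
def incUpTo (d : ℕ) : ℕ → ℕ := fun x => if 1 ≤ x ∧ x ≤ d then x + 1 else x

/-- `inc^d_{i,j}`: maps every `x` with `i ≤ x ≤ j` to `j` and fixes all other inputs. -/
def incIJ (i j : ℕ) : ℕ → ℕ := fun x => if i ≤ x ∧ x ≤ j then j else x

/-- `dec^d_{i,j}`: maps every `x` with `i ≤ x ≤ j` to `i` and fixes all other inputs. -/
def decIJ (i j : ℕ) : ℕ → ℕ := fun x => if i ≤ x ∧ x ≤ j then i else x

/-- The basic functions relative to `d`. -/
def IsBasicFun (d : ℕ) (f : ℕ → ℕ) : Prop :=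
  f = id ∨ (∃ i, 1 ≤ i ∧ i ≤ d ∧ f = decAt i) ∨ f = incUpTo d

/-- The advanced functions relative to `d`. -/
def IsAdvancedFun (d : ℕ) (f : ℕ → ℕ) : Prop :=
  (∃ i, 1 ≤ i ∧ i ≤ d ∧ f = incAt i) ∨
  (∃ i j, 1 ≤ i ∧ i < j ∧ j ≤ d + 1 ∧ f = incIJ i j) ∨
  (∃ i j, i < j ∧ j ≤ d ∧ f = decIJ i j)

/-- The number of fixed points of `f` on the domain `{0, …, d+1}`. -/
def fixCount (d : ℕ) (f : ℕ → ℕ) : ℕ :=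
  ((Finset.range (d + 2)).filter fun x => f x = x).card

/-- The disjoint union of `G₁` and `G₂` together with the edge `a b`. -/
def joinGraph {V₁ V₂ : Type} (G₁ : SimpleGraph V₁) (G₂ : SimpleGraph V₂)
    (a : V₁) (b : V₂) : SimpleGraph (V₁ ⊕ V₂) :=
  SimpleGraph.fromRel fun x y =>
    (∃ u w, x = Sum.inl u ∧ y = Sum.inl w ∧ G₁.Adj u w) ∨
    (∃ u w, x = Sum.inr u ∧ y = Sum.inr w ∧ G₂.Adj u w) ∨
    (x = Sum.inl a ∧ y = Sum.inr b)

/-! ### Coc sets via rooted sets -/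

/-- Every vertex of `C` reaches `r ∈ C` inside `C`; equivalently, `C` is connected in `G`. -/
def RootedAt (G : SimpleGraph V) (C : Set V) (r : V) : Prop :=
  r ∈ C ∧ ∀ u ∈ C, Relation.ReflTransGen (fun a b => G.Adj a b ∧ b ∈ C) u r

/-- `S` is a `d`-coc set of `G[A]` iff every connected subset of `A \ S` has at most `d`
vertices. -/
theorem isCocSetOn_iff_forall_rootedAt [Finite V] {G : SimpleGraph V} {A S : Set V} {d : ℕ} :
    IsCocSetOn G A d S ↔ ∀ C r, C ⊆ A \ S → RootedAt G C r → C.ncard ≤ d := by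
  constructor
  · rintro h C r hC ⟨hr, hreach⟩
    refine le_trans ?_ (h ((G.induce (A \ S)).connectedComponentMk ⟨r, hC hr⟩))
    rw [← Set.ncard_image_of_injective _ Subtype.val_injective]
    refine Set.ncard_le_ncard ?_ (Set.toFinite _)
    intro u hu
    have key : ∀ hu' : u ∈ A \ S, (G.induce (A \ S)).Reachable ⟨u, hu'⟩ ⟨r, hC hr⟩ := by
      induction hreach u hu using Relation.ReflTransGen.head_induction_on with
      | refl => intro _; rfl
      | @head a b hab _ ih =>
        intro ha
        have hadj : (G.induce (A \ S)).Adj ⟨a, ha⟩ ⟨b, hC hab.2⟩ := hab.1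
        exact hadj.reachable.trans (ih hab.2 (hC hab.2))
    exact ⟨⟨u, hC hu⟩, SimpleGraph.ConnectedComponent.sound (key _), rfl⟩
  · intro h c
    rw [← Set.ncard_image_of_injective _ Subtype.val_injective]
    induction c using SimpleGraph.ConnectedComponent.ind with
    | h r =>
      refine h _ r.1 ?_ ⟨⟨r, rfl, rfl⟩, ?_⟩
      · rintro _ ⟨u, _, rfl⟩
        exact u.2
      · rintro _ ⟨u, hu, rfl⟩
        obtain ⟨p⟩ := SimpleGraph.ConnectedComponent.exact hu
        clear h hu
        induction p with
        | nil => exact .refl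
        | @cons a b r hab p ih =>
          exact .head ⟨hab, ⟨b, SimpleGraph.ConnectedComponent.sound ⟨p⟩, rfl⟩⟩ ih

/-- A connected set that avoids `v` lies on one side of any bipartition which is
separated by `v`. -/
theorem RootedAt.subset_or_subset_compl {G : SimpleGraph V} {B C L : Set V} {r v : V}
    (hC : RootedAt G C r) (hCB : C ⊆ B) (hv : v ∉ C)
    (hsep : ∀ u ∈ B, ∀ w ∈ B, u ∈ L → w ∉ L → u ≠ v → w ≠ v → ¬ G.Adj u w) :
    C ⊆ L ∨ C ⊆ Lᶜ := by
  have hside : ∀ u ∈ C, (u ∈ L ↔ r ∈ L) := by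
    intro u hu
    induction hC.2 u hu using Relation.ReflTransGen.head_induction_on with
    | refl => rfl
    | @head a b hab _ ih =>
      rw [← ih hab.2]
      have hav : a ≠ v := fun h => hv (h ▸ hu)
      have hbv : b ≠ v := fun h => hv (h ▸ hab.2)
      by_contra hne
      by_cases ha : a ∈ L
      · exact hsep a (hCB hu) b (hCB hab.2) ha (by tauto) hav hbv hab.1
      · exact hsep b (hCB hab.2) a (hCB hu) (by tauto) ha hbv hav hab.1.symm
  by_cases hr : r ∈ L
  · exact .inl fun u hu => (hside u hu).2 hr
  · exact .inr fun u hu => fun hu' => hr ((hside u hu).1 hu')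

/-- A connected set containing `v` can be rooted at `v`. -/
theorem RootedAt.reroot {G : SimpleGraph V} {C : Set V} {r v : V}
    (hC : RootedAt G C r) (hv : v ∈ C) : RootedAt G C v := by
  refine ⟨hv, fun u hu => (hC.2 u hu).trans ?_⟩
  have key : ∀ w ∈ C, Relation.ReflTransGen (fun a b => G.Adj a b ∧ b ∈ C) r w := by
    intro w hw
    induction hC.2 w hw using Relation.ReflTransGen.head_induction_on with
    | refl => exact .refl
    | @head a b hab _ ih => exact (ih hab.2).tail ⟨hab.1.symm, hw⟩
  exact key v hv

/-- Replacing one side of a connected set through the separator `v` by the side of another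
connected set through `v` yields a connected set. -/
theorem RootedAt.glue {G : SimpleGraph V} {B C D L : Set V} {v : V}
    (hC : RootedAt G C v) (hD : RootedAt G D v) (hCB : C ⊆ B) (hDB : D ⊆ B)
    (hsep : ∀ u ∈ B, ∀ w ∈ B, u ∈ L → w ∉ L → u ≠ v → w ≠ v → ¬ G.Adj u w) :
    RootedAt G ((C ∩ L) ∪ (D \ L)) v := by
  have hvm : v ∈ (C ∩ L) ∪ (D \ L) := by
    by_cases hv : v ∈ L
    · exact .inl ⟨hC.1, hv⟩
    · exact .inr ⟨hD.1, hv⟩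
  refine ⟨hvm, ?_⟩
  rintro u (⟨hu, huL⟩ | ⟨hu, huL⟩)
  · induction hC.2 u hu using Relation.ReflTransGen.head_induction_on with
    | refl => exact .refl
    | @head a b hab _ ih =>
      by_cases hav : a = v
      · rw [hav]
      by_cases hbv : b = v
      · exact .single ⟨hbv ▸ hab.1, hvm⟩
      have hb : b ∈ L := by
        by_contra hb
        exact hsep a (hCB hu) b (hCB hab.2) huL hb hav hbv hab.1
      exact .head ⟨hab.1, .inl ⟨hab.2, hb⟩⟩ (ih hab.2 hb)
  · induction hD.2 u hu using Relation.ReflTransGen.head_induction_on with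
    | refl => exact .refl
    | @head a b hab _ ih =>
      by_cases hav : a = v
      · rw [hav]
      by_cases hbv : b = v
      · exact .single ⟨hbv ▸ hab.1, hvm⟩
      have hb : b ∉ L := by
        intro hb
        exact hsep b (hDB hab.2) a (hDB hu) hb huL hbv hav hab.1.symm
      exact .head ⟨hab.1, .inr ⟨hab.2, hb⟩⟩ (ih hab.2 hb)

/-- A connected set in which `b` has no neighbour is `{b}` if it contains `b`. -/
theorem RootedAt.subset_singleton {G : SimpleGraph V} {C : Set V} {r b : V}
    (hC : RootedAt G C r) (hb : b ∈ C) (hiso : ∀ w ∈ C, ¬ G.Adj b w) : C ⊆ {b} := by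
  intro u hu
  rcases Relation.ReflTransGen.cases_tail ((hC.reroot hb).2 u hu) with h | ⟨w, hw, hwb⟩
  · exact h.symm
  · rcases Relation.ReflTransGen.cases_tail hw with h | ⟨_, _, h⟩
    · exact absurd hwb.1.symm (hiso w (h ▸ hu))
    · exact absurd hwb.1.symm (hiso w h.2)

/-- Removing from a connected set a vertex whose only neighbour is the root keeps it connected. -/
theorem RootedAt.diff_leaf {G : SimpleGraph V} {C : Set V} {v b : V}
    (hC : RootedAt G C v) (hbv : b ≠ v) (hleaf : ∀ w ∈ C, G.Adj b w → w = v) :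
    RootedAt G (C \ {b}) v := by
  have hv : v ∈ C \ {b} := ⟨hC.1, fun h => hbv h.symm⟩
  refine ⟨hv, ?_⟩
  rintro u ⟨hu, hub⟩
  induction hC.2 u hu using Relation.ReflTransGen.head_induction_on with
  | refl => exact .refl
  | @head a c hac _ ih =>
    by_cases hcb : c = b
    · have : a = v := hleaf a hu (hcb ▸ hac.1.symm)
      rw [this]
    · exact .head ⟨hac.1, hac.2, hcb⟩ (ih hac.2 hcb)

/-! ### Minimum coc sets -/

theorem exists_isMinCocSetOn (G : SimpleGraph V) (A : Set V) (d : ℕ) :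
    ∃ T, IsMinCocSetOn G A d T := by
  have hA : IsCocSetOn G A d A := by
    intro c
    induction c using SimpleGraph.ConnectedComponent.ind with
    | h r => exact absurd r.2.1 r.2.2
  obtain ⟨T, h₁, h₂, h₃⟩ := Nat.sInf_mem
    (s := {m : ℕ | ∃ S : Set V, S ⊆ A ∧ IsCocSetOn G A d S ∧ S.ncard = m})
    ⟨A.ncard, A, subset_rfl, hA, rfl⟩
  exact ⟨T, h₁, h₂, h₃⟩

theorem IsCocSetOn.cocOptOn_le {G : SimpleGraph V} {A S : Set V} {d : ℕ}
    (h : IsCocSetOn G A d S) (hS : S ⊆ A) : cocOptOn G A d ≤ S.ncard :=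
  Nat.sInf_le ⟨S, hS, h, rfl⟩

/-- A chunk without conflict has its neighbourhood inside a minimum coc set. -/
theorem exists_isMinCocSetOn_of_not_hasConflict {G : SimpleGraph V} {A X : Set V} {d : ℕ}
    (h : ¬ HasConflict G d A X) : ∃ T, IsMinCocSetOn G A d T ∧ nbrIn G A X ⊆ T := by
  obtain ⟨S, hSA, hS, hcard⟩ := exists_isMinCocSetOn G (A \ nbrIn G A X) d
  have hsub : nbrIn G A X ∪ S ⊆ A :=
    Set.union_subset (fun _ hv => hv.1) (hSA.trans Set.sdiff_subset)
  have hcoc : IsCocSetOn G A d (nbrIn G A X ∪ S) := by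
    unfold IsCocSetOn at hS ⊢
    rwa [← Set.sdiff_sdiff]
  refine ⟨_, ⟨hsub, hcoc, le_antisymm ?_ (hcoc.cocOptOn_le hsub)⟩, Set.subset_union_left⟩
  refine (Set.ncard_union_le _ _).trans ?_
  rw [hcard]
  exact not_lt.1 h

theorem ncard_cross_add [Finite V] (S T L : Set V) :
    ((S ∩ L) ∪ (T \ L)).ncard + ((T ∩ L) ∪ (S \ L)).ncard = S.ncard + T.ncard := by
  have hd : ∀ P Q : Set V, Disjoint (P ∩ L) (Q \ L) := fun P Q =>
    Set.disjoint_left.2 fun _ h h' => h'.2 h.2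
  rw [Set.ncard_union_eq (hd _ _), Set.ncard_union_eq (hd _ _),
    ← Set.ncard_inter_add_ncard_sdiff_eq_ncard S L, ← Set.ncard_inter_add_ncard_sdiff_eq_ncard T L]
  omega

/-- Gluing a set that is coc on one side of `v` with one that is coc on the other side gives
no large connected set avoiding `v`. -/
theorem RootedAt.ncard_le_of_notMem [Finite V] {G : SimpleGraph V} {A T₁ T₂ C L : Set V} {d : ℕ}
    {r v : V} (hT₁ : IsCocSetOn G A d T₁) (hT₂ : IsCocSetOn G A d T₂)
    (hsep : ∀ u ∈ A, ∀ w ∈ A, u ∈ L → w ∉ L → u ≠ v → w ≠ v → ¬ G.Adj u w)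
    (hC : RootedAt G C r) (hCA : C ⊆ A \ ((T₁ ∩ L) ∪ (T₂ \ L))) (hv : v ∉ C) :
    C.ncard ≤ d := by
  rcases hC.subset_or_subset_compl (fun u hu => (hCA hu).1) hv hsep with h | h
  · exact isCocSetOn_iff_forall_rootedAt.1 hT₁ C r
      (fun u hu => ⟨(hCA hu).1, fun hu' => (hCA hu).2 (.inl ⟨hu', h hu⟩)⟩) hC
  · exact isCocSetOn_iff_forall_rootedAt.1 hT₂ C r
      (fun u hu => ⟨(hCA hu).1, fun hu' => (hCA hu).2 (.inr ⟨hu', h hu⟩)⟩) hC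

/-- Two minimum coc sets that contain a vertex `b`, which is a separator `v` or has `v` as its
only neighbour, can be glued along the separator. -/
theorem IsMinCocSetOn.glue [Finite V] {G : SimpleGraph V} {A T₁ T₂ L : Set V} {d : ℕ} {b v : V}
    (hd : 1 ≤ d) (hT₁ : IsMinCocSetOn G A d T₁) (hT₂ : IsMinCocSetOn G A d T₂)
    (hb₁ : b ∈ T₁) (hb₂ : b ∈ T₂) (hbv : b = v ∨ ∀ w ∈ A, G.Adj b w → w = v)
    (hsep : ∀ u ∈ A, ∀ w ∈ A, u ∈ L → w ∉ L → u ≠ v → w ≠ v → ¬ G.Adj u w) :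
    IsMinCocSetOn G A d ((T₁ ∩ L) ∪ (T₂ \ L)) := by
  have hsum := ncard_cross_add T₁ T₂ L
  rw [hT₁.2.2, hT₂.2.2] at hsum
  have hsub : ∀ {P Q : Set V}, P ⊆ A → Q ⊆ A → (P ∩ L) ∪ (Q \ L) ⊆ A := fun hP hQ =>
    Set.union_subset (Set.inter_subset_left.trans hP) (Set.sdiff_subset.trans hQ)
  have hmem : ∀ {P Q : Set V}, b ∈ P → b ∈ Q → b ∈ (P ∩ L) ∪ (Q \ L) := by
    intro P Q hP hQ
    by_cases h : b ∈ L
    · exact .inl ⟨hP, h⟩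
    · exact .inr ⟨hQ, h⟩
  by_cases hbv' : b = v
  · subst hbv'
    have hcoc : ∀ {P Q : Set V}, IsMinCocSetOn G A d P → IsMinCocSetOn G A d Q → b ∈ P → b ∈ Q →
        IsCocSetOn G A d ((P ∩ L) ∪ (Q \ L)) := by
      intro P Q hP hQ hbP hbQ
      refine isCocSetOn_iff_forall_rootedAt.2 fun C r hCA hC => ?_
      exact hC.ncard_le_of_notMem hP.2.1 hQ.2.1 hsep hCA fun h => (hCA h).2 (hmem hbP hbQ)
    have h₁ := (hcoc hT₁ hT₂ hb₁ hb₂).cocOptOn_le (hsub hT₁.1 hT₂.1)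
    have h₂ := (hcoc hT₂ hT₁ hb₂ hb₁).cocOptOn_le (hsub hT₂.1 hT₁.1)
    exact ⟨hsub hT₁.1 hT₂.1, hcoc hT₁ hT₂ hb₁ hb₂, by omega⟩
  have hleaf : ∀ w ∈ A, G.Adj b w → w = v := hbv.resolve_left hbv'
  have hv : ∀ {T : Set V}, IsMinCocSetOn G A d T → b ∈ T → v ∈ A ∧ v ∉ T := by
    intro T hT hb
    by_contra hv
    have hcoc : IsCocSetOn G A d (T \ {b}) := by
      refine isCocSetOn_iff_forall_rootedAt.2 fun C r hCA hC => ?_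
      by_cases hbC : b ∈ C
      · have := hC.subset_singleton hbC fun w hw hbw => by
          have hwv := hleaf w (hCA hw).1 hbw
          subst hwv
          exact hv ⟨(hCA hw).1, fun h => (hCA hw).2 ⟨h, fun h' => hbv' h'.symm⟩⟩
        exact (Set.ncard_le_ncard this).trans (by simpa using hd)
      · exact isCocSetOn_iff_forall_rootedAt.1 hT.2.1 C r
          (fun u hu => ⟨(hCA hu).1, fun h => (hCA hu).2 ⟨h, fun h' => hbC (h' ▸ hu)⟩⟩) hC
    have h₁ := hcoc.cocOptOn_le (Set.sdiff_subset.trans hT.1)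
    have h₂ := Set.ncard_sdiff_singleton_lt_of_mem hb
    have h₃ := hT.2.2
    omega
  have hvA := (hv hT₁ hb₁).1
  have hv₁ := (hv hT₁ hb₁).2
  have hv₂ := (hv hT₂ hb₂).2
  -- exchanging `b` for `v` in a glued set gives a coc set
  have hle : ∀ {P Q : Set V}, IsMinCocSetOn G A d P → IsMinCocSetOn G A d Q → b ∈ P → b ∈ Q →
      cocOptOn G A d ≤ ((P ∩ L) ∪ (Q \ L)).ncard := by
    intro P Q hP hQ hbP hbQ
    have hcoc : IsCocSetOn G A d (insert v (((P ∩ L) ∪ (Q \ L)) \ {b})) := by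
      refine isCocSetOn_iff_forall_rootedAt.2 fun C r hCA hC => ?_
      have hvC : v ∉ C := fun h => (hCA h).2 (.inl rfl)
      by_cases hbC : b ∈ C
      · have := hC.subset_singleton hbC fun w hw hbw =>
          hvC (hleaf w (hCA hw).1 hbw ▸ hw)
        exact (Set.ncard_le_ncard this).trans (by simpa using hd)
      · exact hC.ncard_le_of_notMem hP.2.1 hQ.2.1 hsep (fun u hu => ⟨(hCA hu).1, fun h =>
          (hCA hu).2 (.inr ⟨h, fun h' => hbC (h' ▸ hu)⟩)⟩) hvC
    refine (hcoc.cocOptOn_le (Set.insert_subset hvA (Set.sdiff_subset.trans (hsub hP.1 hQ.1)))).trans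
      ((Set.ncard_insert_le _ _).trans ?_)
    rw [Set.ncard_sdiff_singleton_add_one (hmem hbP hbQ)]
  have h₁ := hle hT₁ hT₂ hb₁ hb₂
  have h₂ := hle hT₂ hT₁ hb₂ hb₁
  refine ⟨hsub hT₁.1 hT₂.1, ?_, by omega⟩
  by_contra hncoc
  have hcoc' : IsCocSetOn G A d (((T₂ ∩ L) ∪ (T₁ \ L)) \ {b}) := by
    rw [isCocSetOn_iff_forall_rootedAt] at hncoc
    push Not at hncoc
    obtain ⟨C, r, hCA, hC, hCd⟩ := hncoc
    have hvC : v ∈ C := by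
      by_contra h
      exact absurd (hC.ncard_le_of_notMem hT₁.2.1 hT₂.2.1 hsep hCA h) (by omega)
    have hbC : b ∉ C := fun h => (hCA h).2 (hmem hb₁ hb₂)
    replace hC := hC.reroot hvC
    refine isCocSetOn_iff_forall_rootedAt.2 fun D r hDA hD => ?_
    by_cases hvD : v ∈ D
    · replace hD := (hD.reroot hvD).diff_leaf hbv' fun w hw => hleaf w (hDA hw).1
      have hDA' : ∀ u ∈ D \ {b}, u ∈ A \ ((T₂ ∩ L) ∪ (T₁ \ L)) := fun u hu =>
        ⟨(hDA hu.1).1, fun h => (hDA hu.1).2 ⟨h, hu.2⟩⟩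
      have e₁ := isCocSetOn_iff_forall_rootedAt.1 hT₁.2.1 _ _ (by
        rintro u (hu | hu)
        · exact ⟨(hCA hu.1).1, fun h => (hCA hu.1).2 (.inl ⟨h, hu.2⟩)⟩
        · exact ⟨(hDA' u hu.1).1, fun h => (hDA' u hu.1).2 (.inr ⟨h, hu.2⟩)⟩)
        (hC.glue hD (fun u hu => (hCA hu).1) (fun u hu => (hDA' u hu).1) hsep)
      have e₂ := isCocSetOn_iff_forall_rootedAt.1 hT₂.2.1 _ _ (by
        rintro u (hu | hu)
        · exact ⟨(hDA' u hu.1).1, fun h => (hDA' u hu.1).2 (.inl ⟨h, hu.2⟩)⟩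
        · exact ⟨(hCA hu.1).1, fun h => (hCA hu.1).2 (.inr ⟨h, hu.2⟩)⟩)
        (hD.glue hC (fun u hu => (hDA' u hu).1) (fun u hu => (hCA hu).1) hsep)
      have e₃ := ncard_cross_add C (D \ {b}) L
      have e₄ := Set.pred_ncard_le_ncard_sdiff_singleton D b
      omega
    · by_cases hbD : b ∈ D
      · have := hD.subset_singleton hbD fun w hw hbw => hvD (hleaf w (hDA hw).1 hbw ▸ hw)
        exact (Set.ncard_le_ncard this).trans (by simpa using hd)
      · exact hD.ncard_le_of_notMem hT₂.2.1 hT₁.2.1 hsep (fun u hu => ⟨(hDA hu).1, fun h =>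
          (hDA hu).2 ⟨h, fun h' => hbD (h' ▸ hu)⟩⟩) hvD
  have h₃ := hcoc'.cocOptOn_le (Set.sdiff_subset.trans (hsub hT₂.1 hT₁.1))
  have h₄ := Set.ncard_sdiff_singleton_lt_of_mem (hmem (P := T₂) (Q := T₁) hb₂ hb₁)
  omega

/-! ### Separation in caterpillar forests -/

/-- Some member `b` of `F` separates two other members of `F` in `G[B]`, in the sense that
they lie on different sides of a vertex `v` which is `b` or the only neighbour of `b`. -/
def HasSeparator (G : SimpleGraph V) (B F : Set V) : Prop :=
  ∃ b ∈ F, ∃ y ∈ F, ∃ z ∈ F, b ≠ y ∧ b ≠ z ∧ ∃ (v : V) (L : Set V),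
    (b = v ∨ ∀ w ∈ B, G.Adj b w → w = v) ∧ y ∈ L ∧ z ∉ L ∧
    ∀ u ∈ B, ∀ w ∈ B, u ∈ L → w ∉ L → u ≠ v → w ≠ v → ¬ G.Adj u w

theorem HasSeparator.of_induce {G : SimpleGraph V} {B F : Set V}
    (h : HasSeparator (G.induce B) Set.univ (Subtype.val ⁻¹' F)) : HasSeparator G B F := by
  obtain ⟨b, hb, y, hy, z, hz, hby, hbz, v, L, hv, hyL, hzL, hsep⟩ := h
  refine ⟨b, hb, y, hy, z, hz, Subtype.coe_ne_coe.2 hby, Subtype.coe_ne_coe.2 hbz, v,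
    Subtype.val '' L, ?_, ⟨y, hyL, rfl⟩, ?_, ?_⟩
  · refine hv.imp (congrArg _) fun h w hw hbw => ?_
    exact congrArg Subtype.val (h ⟨w, hw⟩ trivial hbw)
  · rintro ⟨z', hz', h⟩
    exact hzL (Subtype.ext h ▸ hz')
  · rintro _ _ w hw ⟨u, hu, rfl⟩ hwL huv hwv
    exact hsep u trivial ⟨w, hw⟩ trivial hu (fun h => hwL ⟨_, h, rfl⟩)
      (fun h => huv (congrArg _ h)) (fun h => hwv (congrArg Subtype.val h))

theorem HasSeparator.of_component {G : SimpleGraph V} {c : G.ConnectedComponent} {F : Set V}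
    (h : HasSeparator G c.supp F) (hF : F ⊆ c.supp) : HasSeparator G Set.univ F := by
  obtain ⟨b, hb, y, hy, z, hz, hby, hbz, v, L, hv, hyL, hzL, hsep⟩ := h
  have hadj : ∀ {u w : V}, u ∈ c.supp → G.Adj u w → w ∈ c.supp := fun hu huw =>
    (SimpleGraph.ConnectedComponent.mem_supp_congr_adj c huw).1 hu
  refine ⟨b, hb, y, hy, z, hz, hby, hbz, v, L ∩ c.supp, ?_, ⟨hyL, hF hy⟩, fun h => hzL h.1, ?_⟩
  · exact hv.imp_right fun h w _ hbw => h w (hadj (hF hb) hbw) hbw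
  · rintro u _ w _ ⟨hu, huc⟩ hwL huv hwv huw
    have hwc := hadj huc huw
    exact hsep u huc w hwc hu (fun h => hwL ⟨h, hwc⟩) huv hwv huw

theorem HasSeparator.mono {G : SimpleGraph V} {B F F' : Set V}
    (h : HasSeparator G B F) (hF : F ⊆ F') : HasSeparator G B F' := by
  obtain ⟨b, hb, y, hy, z, hz, h⟩ := h
  exact ⟨b, hF hb, y, hF hy, z, hF hz, h⟩

theorem IsCaterpillar.hasSeparator {G : SimpleGraph V} (hG : IsCaterpillar G) {F : Set V}
    {x y z : V} (hx : x ∈ F) (hy : y ∈ F) (hz : z ∈ F) (hxy : x ≠ y) (hxz : x ≠ z)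
    (hyz : y ≠ z) : HasSeparator G Set.univ F := by
  obtain ⟨htree, n, ⟨e⟩⟩ := hG
  set D : Set V := {v : V | (G.neighborSet v).ncard ≠ 1}
  have hpar : ∀ w, ∃ p : D, (w ∈ D → p.1 = w) ∧ (w ∉ D → ∀ u, G.Adj w u → u = p.1) := by
    intro w
    by_cases hw : w ∈ D
    · exact ⟨⟨w, hw⟩, fun _ => rfl, fun h => absurd hw h⟩
    · obtain ⟨p, hp⟩ := Set.ncard_eq_one.1 (not_not.1 hw)
      have hwp : ∀ u, G.Adj w u ↔ u = p := fun u => by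
        rw [← SimpleGraph.mem_neighborSet, hp, Set.mem_singleton_iff]
      refine ⟨⟨p, fun hp1 => ?_⟩, fun h => absurd h hw, fun _ u hu => (hwp u).1 hu⟩
      obtain ⟨q, hq⟩ := Set.ncard_eq_one.1 hp1
      have hpq : ∀ u, G.Adj p u ↔ u = q := fun u => by
        rw [← SimpleGraph.mem_neighborSet, hq, Set.mem_singleton_iff]
      have hwq : w = q := (hpq w).1 ((hwp p).2 rfl).symm
      have hall : ∀ u, u = w ∨ u = p := by
        intro u
        obtain ⟨walk⟩ := htree.connected.preconnected u w
        induction walk with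
        | nil => exact .inl rfl
        | @cons a c w hac _ ih =>
          rcases ih hw hp hwp hwq with h | h
          · exact .inr ((hwp a).1 (h ▸ hac.symm))
          · exact .inl (hwq ▸ (hpq a).1 (h ▸ hac.symm))
      rcases hall x with h | h <;> rcases hall y with h' | h' <;> rcases hall z with h'' | h'' <;>
        subst_vars <;> simp_all
  choose par hparD hparL using hpar
  have hmiddle : ∀ x ∈ F, ∀ y ∈ F, ∀ z ∈ F, x ≠ y → x ≠ z → y ≠ z →
      e (par x) ≤ e (par y) → e (par y) ≤ e (par z) → HasSeparator G Set.univ F := by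
    intro x hx y hy z hz hxy hxz hyz hle hle'
    refine ⟨y, hy, x, hx, z, hz, hxy.symm, hyz, par y,
      insert x {w | e (par w) < e (par y)}, ?_, .inl rfl, ?_, ?_⟩
    · by_cases hyD : y ∈ D
      · exact .inl (hparD y hyD).symm
      · exact .inr fun w _ => hparL y hyD w
    · rintro (h | h)
      · exact hxz h.symm
      · exact absurd h (not_lt.2 hle')
    · intro u _ w _ huL hwL huv hwv huw
      have hw : ¬ e (par w) < e (par y) := fun h => hwL (.inr h)
      by_cases hu : e (par u) < e (par y)
      · have huD : u ∈ D := by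
          by_contra h
          have h₁ := hparL u h w huw
          have h₂ : par w = par u :=
            Subtype.ext ((hparD w (h₁ ▸ (par u).2)).trans h₁)
          exact hw (h₂ ▸ hu)
        have hwD : w ∈ D := by
          by_contra h
          have h₁ := hparL w h u huw.symm
          have h₂ : par u = par w :=
            Subtype.ext ((hparD u (h₁ ▸ (par w).2)).trans h₁)
          exact hw (h₂ ▸ hu)
        have hadj : (G.induce D).Adj (par u) (par w) := by
          show G.Adj (par u).1 (par w).1
          rwa [hparD u huD, hparD w hwD]
        have hpath := SimpleGraph.pathGraph_adj.1 (e.map_adj_iff.2 hadj)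
        have heq : e (par w) = e (par y) := by
          apply Fin.ext
          rw [Fin.lt_def] at hu hw
          omega
        exact hwv ((hparD w hwD).symm.trans (congrArg Subtype.val (e.injective heq)))
      · rcases huL with rfl | h
        · have heq := e.injective (le_antisymm hle (not_lt.1 hu))
          by_cases huD : u ∈ D
          · exact huv ((hparD u huD).symm.trans (congrArg Subtype.val heq))
          · exact hwv ((hparL u huD w huw).trans (congrArg Subtype.val heq))
        · exact hu h
  rcases le_total (e (par x)) (e (par y)) with h₁ | h₁ <;>
  rcases le_total (e (par y)) (e (par z)) with h₂ | h₂ <;>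
  rcases le_total (e (par x)) (e (par z)) with h₃ | h₃
  · exact hmiddle x hx y hy z hz hxy hxz hyz h₁ h₂
  · exact hmiddle x hx y hy z hz hxy hxz hyz h₁ h₂
  · exact hmiddle x hx z hz y hy hxz hxy hyz.symm h₃ h₂
  · exact hmiddle z hz x hx y hy hxz.symm hyz.symm hxy h₃ h₁
  · exact hmiddle y hy x hx z hz hxy.symm hyz hxz h₁ h₃
  · exact hmiddle y hy z hz x hx hyz hxy.symm hxz.symm h₂ h₃
  · exact hmiddle z hz y hy x hx hyz.symm hxz.symm hxy.symm h₂ h₁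
  · exact hmiddle z hz y hy x hx hyz.symm hxz.symm hxy.symm h₂ h₁

theorem IsCaterpillarForest.hasSeparator {G : SimpleGraph V} (hG : IsCaterpillarForest G)
    {F : Set V} {x y z : V} (hx : x ∈ F) (hy : y ∈ F) (hz : z ∈ F) (hxy : x ≠ y) (hxz : x ≠ z)
    (hyz : y ≠ z) : HasSeparator G Set.univ F := by
  have hsplit : ∀ b ∈ F, ∀ y ∈ F, ∀ z ∈ F, b ≠ y → b ≠ z →
      G.connectedComponentMk y ≠ G.connectedComponentMk z → HasSeparator G Set.univ F := by
    intro b hb y hy z hz hby hbz hne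
    refine ⟨b, hb, y, hy, z, hz, hby, hbz, b, (G.connectedComponentMk y).supp, .inl rfl, rfl,
      fun h => hne h.symm, fun u _ w _ hu hw _ _ huw => hw ?_⟩
    exact (SimpleGraph.ConnectedComponent.mem_supp_congr_adj _ huw).1 hu
  by_cases hxy' : G.connectedComponentMk x = G.connectedComponentMk y
  · by_cases hxz' : G.connectedComponentMk x = G.connectedComponentMk z
    · set c := G.connectedComponentMk x
      have h := (hG c).hasSeparator (F := Subtype.val ⁻¹' (F ∩ c.supp))
        (x := ⟨x, rfl⟩) (y := ⟨y, hxy'.symm⟩) (z := ⟨z, hxz'.symm⟩) ⟨hx, rfl⟩ ⟨hy, hxy'.symm⟩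
        ⟨hz, hxz'.symm⟩ (fun h => hxy (congrArg Subtype.val h)) (fun h => hxz (congrArg Subtype.val h)) (fun h => hyz (congrArg Subtype.val h))
      exact (h.of_induce.of_component Set.inter_subset_right).mono Set.inter_subset_left
    · exact hsplit y hy x hx z hz hxy.symm hyz hxz'
  · exact hsplit z hz x hx y hy hxz.symm hyz.symm hxy'

/-- Blocking sets of caterpillar forests satisfy a Helly property: a set all of whose pairs lie
in minimum coc sets lies in a minimum coc set. -/
theorem exists_isMinCocSetOn_superset [Finite V] {G : SimpleGraph V} {A B : Set V} {d : ℕ}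
    (hd : 1 ≤ d) (hforest : IsCaterpillarForest (G.induce B)) (hA : A ⊆ B) (F : Set V)
    (hFA : F ⊆ A)
    (hpair : ∀ x ∈ F, ∀ y ∈ F, ∃ T, IsMinCocSetOn G A d T ∧ x ∈ T ∧ y ∈ T) :
    ∃ T, IsMinCocSetOn G A d T ∧ F ⊆ T := by
  induction hn : F.ncard using Nat.strong_induction_on generalizing F with
  | _ n ih =>
  subst hn
  rcases lt_or_ge 2 F.ncard with h2 | h2
  · obtain ⟨x, hx, y, hy, z, hz, hxy, hxz, hyz⟩ := (Set.two_lt_ncard F.toFinite).1 h2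
    have hs : HasSeparator G B F := HasSeparator.of_induce <|
      hforest.hasSeparator (x := ⟨x, hA (hFA hx)⟩) (y := ⟨y, hA (hFA hy)⟩)
        (z := ⟨z, hA (hFA hz)⟩) hx hy hz (fun h => hxy (congrArg Subtype.val h)) (fun h => hxz (congrArg Subtype.val h))
        (fun h => hyz (congrArg Subtype.val h))
    obtain ⟨b, hb, y, hy, z, hz, hby, hbz, v, L, hv, hyL, hzL, hsep⟩ := hs
    have hdel : ∀ w ∈ F, ∃ T, IsMinCocSetOn G A d T ∧ F \ {w} ⊆ T := fun w hw =>
      ih _ (Set.ncard_sdiff_singleton_lt_of_mem hw) (F \ {w}) (Set.sdiff_subset.trans hFA)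
        (fun x hx y hy => hpair x hx.1 y hy.1) rfl
    obtain ⟨T₁, hT₁, hF₁⟩ := hdel z hz
    obtain ⟨T₂, hT₂, hF₂⟩ := hdel y hy
    refine ⟨_, hT₁.glue hd hT₂ (hF₁ ⟨hb, hbz⟩) (hF₂ ⟨hb, hby⟩)
      (hv.imp_right fun h w hw => h w (hA hw))
      (fun u hu w hw => hsep u (hA hu) w (hA hw)), fun w hw => ?_⟩
    by_cases hwL : w ∈ L
    · exact .inl ⟨hF₁ ⟨hw, fun h => hzL (h ▸ hwL)⟩, hwL⟩
    · exact .inr ⟨hF₂ ⟨hw, fun h => hwL (h ▸ hyL)⟩, hwL⟩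
  · rcases F.eq_empty_or_nonempty with rfl | ⟨x, hx⟩
    · obtain ⟨T, hT⟩ := exists_isMinCocSetOn G A d
      exact ⟨T, hT, Set.empty_subset _⟩
    · have h1 : (F \ {x}).ncard ≤ 1 := by
        have := Set.ncard_sdiff_singleton_add_one hx
        omega
      rcases (F \ {x}).eq_empty_or_nonempty with h0 | ⟨y, hy⟩
      · obtain ⟨T, hT, hxT, _⟩ := hpair x hx x hx
        refine ⟨T, hT, fun w hw => ?_⟩
        by_cases hwx : w = x
        · exact hwx ▸ hxT
        · exact absurd (show w ∈ F \ {x} from ⟨hw, hwx⟩) (h0 ▸ Set.notMem_empty w)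
      · obtain ⟨T, hT, hxT, hyT⟩ := hpair x hx y hy.1
        refine ⟨T, hT, fun w hw => ?_⟩
        by_cases hwx : w = x
        · exact hwx ▸ hxT
        · exact ((Set.ncard_le_one).1 h1 w ⟨hw, hwx⟩ y hy) ▸ hyT

/-- Let `G` be a finite simple graph, `d ≥ 1`, `M` such that `G − M`
is a caterpillar forest, `S ⊆ M`, and `H` a subgraph of `G − M` (on vertex set `A`) such
that `S ∩ X ≠ ∅` for every chunk `X` with `conf_H(X) > 0`. Then there is a minimum
`d`-coc set of `H` containing all vertices of `H` adjacent to some vertex of `M \ S`. -/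
theorem stmt18 {V : Type} [Fintype V] (G : SimpleGraph V) (M : Set V)
    (d : ℕ) (hd : 1 ≤ d)
    (hforest : IsCaterpillarForest (G.induce Mᶜ))
    (S : Set V) (hS : S ⊆ M) (A : Set V) (hA : A ⊆ Mᶜ)
    (hhit : ∀ X : Set V, IsChunk M X → HasConflict G d A X → (S ∩ X).Nonempty) :
    ∃ T : Set V, IsMinCocSetOn G A d T ∧
      ∀ v ∈ A, (∃ m ∈ M \ S, G.Adj v m) → v ∈ T := by
  have hpair : ∀ x ∈ nbrIn G A (M \ S), ∀ y ∈ nbrIn G A (M \ S),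
      ∃ T, IsMinCocSetOn G A d T ∧ x ∈ T ∧ y ∈ T := by
    rintro x ⟨hx, m, hm, hxm⟩ y ⟨hy, m', hm', hym'⟩
    have hchunk : IsChunk M {m, m'} :=
      ⟨Set.insert_subset hm.1 (Set.singleton_subset_iff.2 hm'.1),
        (Set.ncard_pos (Set.toFinite _)).2 ⟨m, .inl rfl⟩, (Set.ncard_insert_le _ _).trans (by simp)⟩
    have hno : ¬ HasConflict G d A {m, m'} := fun h => by
      obtain ⟨w, hwS, rfl | rfl⟩ := hhit _ hchunk h
      · exact hm.2 hwS
      · exact hm'.2 hwS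
    obtain ⟨T, hT, hsub⟩ := exists_isMinCocSetOn_of_not_hasConflict hno
    exact ⟨T, hT, hsub ⟨hx, m, .inl rfl, hxm⟩, hsub ⟨hy, m', .inr rfl, hym'⟩⟩
  obtain ⟨T, hT, hsub⟩ :=
    exists_isMinCocSetOn_superset hd hforest hA _ (fun _ hv => hv.1) hpair
  exact ⟨T, hT, fun v hv hm => hsub ⟨hv, hm⟩⟩

end CocPaper
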